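/- Let T be a real vector space and let T ∈ S^k T* ⊗ Λ² T* be a tensor of k+2 arguments, symmetric in the first k arguments and antisymmetric in the last two, which satisfies the Bianchi identity in the last three arguments (the cyclic sum over the last three arguments vanishes) and satisfies ∑_{s=1}^{k+1} T(X₁,…,X̂ₛ,…,X_{k+1}, Xₛ, X_{k+2}) = 0 for all vectors X₁,…,X_{k+2}. Then T = 0. -/

import Mathlib

/-- The tuple of length `k + 2` with first `k` entries `g`, followed by `x` and `y`. -/
def snocPair {V : Type*} {k : ℕ} (g : Fin k → V) (x y : V) (i : Fin (k + 2)) : V :=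
  if h : (i : ℕ) < k then g ⟨i, h⟩ else if (i : ℕ) = k then x else y

theorem exists_eq_snocPair {V : Type*} {k : ℕ} (v : Fin (k + 2) → V) :
    ∃ g x y, v = snocPair g x y := by
  refine ⟨fun i => v ⟨i, by omega⟩, v ⟨k, by omega⟩, v ⟨k + 1, by omega⟩, ?_⟩
  funext i
  unfold snocPair
  split_ifs with h h'
  · rfl
  · exact congrArg v (Fin.ext h')
  · exact congrArg v (Fin.ext (by dsimp only; omega))

theorem cons_comp_succAbove_comp_cycleRange {V : Type*} {k : ℕ} (g : Fin k → V) (x : V)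
    (i : Fin k) :
    (fun j => (Fin.cons x g : Fin (k + 1) → V) (i.succ.succAbove j)) ∘ i.cycleRange
      = Function.update g i x := by
  funext j
  simp only [Function.comp_apply, Fin.succAbove_cycleRange]
  by_cases h : j = i
  · subst h
    simp
  · rw [Equiv.swap_apply_of_ne_of_ne (Fin.succ_ne_zero j) (by simpa using h)]
    simp [h]

theorem update_comp_swap {ι V : Type*} [DecidableEq ι] (g : ι → V) (i l : ι) (x : V) :
    Function.update (g ∘ Equiv.swap i l) l x = Function.update g i x ∘ Equiv.swap i l := by
  rw [← Equiv.swap_apply_left i l, Function.update_comp_equiv]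
  simp

/-- A function of `k + 2` arguments, symmetric in the first `k` and antisymmetric in the last two,
vanishes if it satisfies the Bianchi identity and its symmetrization over the first `k + 1`
arguments vanishes. -/
theorem eq_zero_of_bianchi_of_sum {V : Type*} {k : ℕ} (F : (Fin k → V) → V → V → ℝ)
    (l : Fin k)
    (hswap : ∀ g x y i j, F (g ∘ Equiv.swap i j) x y = F g x y)
    (hskew : ∀ g x y, F g y x = -F g x y)
    (hbianchi : ∀ g x y, F g x y + F (Function.update g l y) (g l) x
      + F (Function.update g l x) y (g l) = 0)
    (hsum : ∀ (v : Fin (k + 1) → V) (y : V),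
      ∑ s, F (fun i => v (s.succAbove i)) (v s) y = 0)
    (g : Fin k → V) (x y : V) : F g x y = 0 := by
  have hperm : ∀ (σ : Equiv.Perm (Fin k)) (g x y), F (g ∘ σ) x y = F g x y := by
    intro σ
    induction σ using Equiv.Perm.swap_induction_on' with
    | one => intros; rfl
    | mul_swap σ i j _ ih =>
      intro g x y
      rw [Equiv.Perm.coe_mul, ← Function.comp_assoc, hswap, ih]
  have hbianchi' : ∀ i, F (Function.update g i x) (g i) y
      = F g x y + F (Function.update g i y) (g i) x := by
    intro i
    have h := hbianchi (g ∘ Equiv.swap i l) x y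
    simp only [update_comp_swap, hswap, Function.comp_apply, Equiv.swap_apply_right] at h
    linarith [hskew (Function.update g i x) (g i) y]
  have hsum' : ∀ x y, F g x y + ∑ i, F (Function.update g i x) (g i) y = 0 := by
    intro x y
    have h := hsum (Fin.cons x g) y
    rw [Fin.sum_univ_succ] at h
    simpa only [Fin.succAbove_zero, Fin.cons_succ, Fin.cons_zero,
      ← cons_comp_succAbove_comp_cycleRange, hperm] using h
  have hxy := hsum' x y
  have hyx := hsum' y x
  simp only [hbianchi', Finset.sum_add_distrib, Finset.sum_const, Finset.card_univ,
    Fintype.card_fin, nsmul_eq_mul] at hxy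
  have h : ((k : ℝ) + 2) * F g x y = 0 := by linarith [hskew g x y]
  exact (mul_eq_zero.mp h).resolve_left (by positivity)

/-- Lemma 3 of the paper: let `T ∈ S^k T* ⊗ Λ² T*` be a `(k+2)`-linear form,
symmetric in the first `k` arguments and antisymmetric in the last two, satisfying the
Bianchi identity in the last three arguments and
`∑_{s=1}^{k+1} T(X₁,…,X̂ₛ,…,X_{k+1}, Xₛ, X_{k+2}) = 0`.  Then `T = 0`. -/
theorem tensor_vanishes_of_bianchi_and_sum {V : Type*} [AddCommGroup V] [Module ℝ V]
    (k : ℕ) (hk : 1 ≤ k)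
    (T : MultilinearMap ℝ (fun _ : Fin (k + 2) => V) ℝ)
    -- symmetry in the first `k` arguments
    (hsym : ∀ (v : Fin (k + 2) → V) (i j : Fin (k + 2)), (i : ℕ) < k → (j : ℕ) < k →
      T (v ∘ Equiv.swap i j) = T v)
    -- antisymmetry in the last two arguments
    (hskew : ∀ v : Fin (k + 2) → V,
      T (v ∘ Equiv.swap (⟨k, by omega⟩ : Fin (k + 2)) (⟨k + 1, by omega⟩ : Fin (k + 2)))
        = - T v)
    -- the Bianchi identity in the last three arguments: the cyclic sum vanishes
    (hbianchi : ∀ v : Fin (k + 2) → V,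
      T v
        + T (v ∘ ((Equiv.swap (⟨k - 1, by omega⟩ : Fin (k + 2)) (⟨k, by omega⟩ : Fin (k + 2))).trans
              (Equiv.swap (⟨k, by omega⟩ : Fin (k + 2)) (⟨k + 1, by omega⟩ : Fin (k + 2)))))
        + T (v ∘ (((Equiv.swap (⟨k - 1, by omega⟩ : Fin (k + 2)) (⟨k, by omega⟩ : Fin (k + 2))).trans
              (Equiv.swap (⟨k, by omega⟩ : Fin (k + 2)) (⟨k + 1, by omega⟩ : Fin (k + 2)))).trans
            ((Equiv.swap (⟨k - 1, by omega⟩ : Fin (k + 2)) (⟨k, by omega⟩ : Fin (k + 2))).trans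
              (Equiv.swap (⟨k, by omega⟩ : Fin (k + 2)) (⟨k + 1, by omega⟩ : Fin (k + 2))))))
        = 0)
    -- the hypothesis (82): `∑_{s=1}^{k+1} T(X₁,…,X̂ₛ,…,X_{k+1}, Xₛ, X_{k+2}) = 0`
    (hsum : ∀ (v : Fin (k + 1) → V) (X : V),
      (∑ s : Fin (k + 1), T (fun i : Fin (k + 2) =>
        if h : (i : ℕ) < k then v (s.succAbove ⟨(i : ℕ), h⟩)
        else if (i : ℕ) = k then v s else X)) = 0) :
    T = 0 := by
  have hlt : k - 1 < k := by omega
  ext v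
  obtain ⟨g, x, y, rfl⟩ := exists_eq_snocPair v
  refine eq_zero_of_bianchi_of_sum (fun g x y => T (snocPair g x y)) ⟨k - 1, hlt⟩
    ?_ ?_ ?_ hsum g x y
  · intro g x y i j
    rw [← hsym (snocPair g x y) ⟨i, by omega⟩ ⟨j, by omega⟩ i.isLt j.isLt]
    congr 1
    funext n
    simp only [snocPair, Function.comp_apply, Equiv.swap_apply_def, Fin.ext_iff]
    split_ifs <;> grind
  · intro g x y
    rw [← hskew]
    congr 1
    funext n
    simp only [snocPair, Function.comp_apply, Equiv.swap_apply_def, Fin.ext_iff]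
    grind
  · intro g x y
    rw [← hbianchi (snocPair g x y)]
    congr 3 <;>
    · funext n
      simp only [snocPair, Function.comp_apply, Equiv.trans_apply, Equiv.swap_apply_def,
        Function.update_apply, Fin.ext_iff]
      grind
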